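/- arXiv:math/0211341 — 2 statements merged into one kernel-verified Lean document; each statement's English description precedes it below -/
import Mathlib

section
/- For every finite-dimensional subspace A of a Banach space Y there exists a bounded linear projection P from Y onto A with operator norm at most the square root of the dimension of A. -/
open Matrix in
theorem ks_isCompact_convexHull {E : Type*} [AddCommGroup E] [Module ℝ E] [TopologicalSpace E]
    [IsTopologicalAddGroup E] [ContinuousSMul ℝ E] [FiniteDimensional ℝ E] {s : Set E}
    (hs : IsCompact s) : IsCompact (convexHull ℝ s) := by
  have key : convexHull ℝ s = ⋃ k ∈ Finset.range (Module.finrank ℝ E + 2),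
      (fun p : (Fin k → ℝ) × (Fin k → E) => ∑ i, p.1 i • p.2 i) ''
        (stdSimplex ℝ (Fin k) ×ˢ Set.pi Set.univ (fun _ => s)) := by
    apply Set.Subset.antisymm
    · intro x hx
      obtain ⟨ι, _, z, w, hz, hi, hw, hw1, hx⟩ := eq_pos_convex_span_of_mem_convexHull hx
      have hc := hi.card_le_finrank_succ
      have hc2 := Submodule.finrank_le (vectorSpan ℝ (Set.range z))
      let e := Fintype.equivFin ι
      simp only [Set.mem_iUnion]
      refine ⟨Fintype.card ι, Finset.mem_range.2 (by omega), (w ∘ e.symm, z ∘ e.symm), ⟨⟨?_, ?_⟩, ?_⟩, ?_⟩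
      · intro i; exact (hw _).le
      · rw [← hw1]; exact Equiv.sum_comp e.symm w
      · intro i _; exact hz ⟨_, rfl⟩
      · rw [← hx]; exact Equiv.sum_comp e.symm (fun i => w i • z i)
    · intro x hx
      simp only [Set.mem_iUnion] at hx
      obtain ⟨k, _, ⟨w, z⟩, ⟨⟨h1, h2⟩, h3⟩, rfl⟩ := hx
      exact mem_convexHull_of_exists_fintype w z h1 h2 (fun i => h3 i trivial) rfl
  rw [key]
  refine Finset.isCompact_biUnion _ fun k _ => ?_
  refine IsCompact.image ((isCompact_stdSimplex ℝ (Fin k)).prod (isCompact_univ_pi fun _ => hs)) ?_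
  fun_prop

open Matrix in
theorem ks_det {n : ℕ} (M : Matrix (Fin n) (Fin n) ℝ) (hM : M.det ≠ 0) (v : Fin n → ℝ)
    (t : ℝ) : (M + t • vecMulVec v v).det = M.det * (1 + t * (v ⬝ᵥ M⁻¹ *ᵥ v)) := by
  have h := det_add_replicateCol_mul_replicateRow (ι := Unit) (A := M) (isUnit_iff_ne_zero.2 hM)
    (t • v) v
  rw [← vecMulVec_eq, smul_vecMulVec] at h
  rw [h, det_unique (n := Unit)]
  congr 1
  simp only [Matrix.add_apply, one_apply_eq]
  congr 1
  rw [Matrix.mul_assoc, ← replicateCol_mulVec, replicateRow_mul_replicateCol_apply, mulVec_smul,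
    dotProduct_smul, smul_eq_mul]

theorem ks_real (n : ℕ) (hn : 0 < n) (q : ℝ)
    (h : ∀ t : ℝ, 0 < t → t < 1 → (1 - t) ^ n * (1 + t / (1 - t) * q) ≤ 1) : q ≤ n := by
  by_contra! hq
  obtain ⟨m, rfl⟩ : ∃ m, n = m + 1 := ⟨n - 1, by omega⟩
  push_cast at hq
  have hm : (0 : ℝ) ≤ m := Nat.cast_nonneg m
  -- choose t
  set D : ℝ := (m + 1) * q + (q - (m + 1)) + 1 with hD
  have hDpos : 0 < D := by nlinarith
  set t : ℝ := (q - (m + 1)) / D with ht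
  have htD : t * D = q - (m + 1) := by rw [ht]; field_simp
  have ht0 : 0 < t := div_pos (by linarith) hDpos
  have ht1 : t < 1 := by rw [ht, div_lt_one hDpos]; nlinarith
  have h1 := h t ht0 ht1
  have hne : 1 - t ≠ 0 := by linarith
  have h2 : (1 - t) ^ (m + 1) * (1 + t / (1 - t) * q) = (1 - t) ^ m * (1 - t + t * q) := by
    rw [pow_succ]; field_simp
  rw [h2] at h1
  have hb := one_add_mul_le_pow (a := -t) (by linarith) m
  have hb' : 1 - m * t ≤ (1 - t) ^ m := by
    have e : (1 : ℝ) + -t = 1 - t := by ring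
    rw [e] at hb; linarith
  have h3 : 0 < 1 - t + t * q := by nlinarith
  have h4 := mul_le_mul_of_nonneg_right hb' h3.le
  have h5 : t * ((q - (m + 1)) - t * (m * (q - 1))) ≤ 0 := by nlinarith
  have h6 : (q - (m + 1)) - t * (m * (q - 1)) ≤ 0 := by
    by_contra! hh
    nlinarith [mul_pos ht0 hh]
  have h7 : t * (D - m * (q - 1)) ≤ 0 := by linarith
  have h8 : 0 < D - m * (q - 1) := by rw [hD]; nlinarith
  nlinarith [mul_pos ht0 h8]

open Matrix in
theorem ks_design {n : ℕ} (hn : 0 < n) (K : Set (Fin n → ℝ)) (hK : IsCompact K) (ε : ℝ)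
    (hε : 0 < ε) (hKε : ∀ i, Pi.single i ε ∈ K) :
    ∃ (ι : Type) (_ : Fintype ι) (w : ι → ℝ) (v : ι → Fin n → ℝ),
      (∀ i, 0 ≤ w i) ∧ ∑ i, w i = 1 ∧ (∀ i, v i ∈ K) ∧
      (∑ i, w i • vecMulVec (v i) (v i)).det ≠ 0 ∧
      ∀ u ∈ K, u ⬝ᵥ (∑ i, w i • vecMulVec (v i) (v i))⁻¹ *ᵥ u ≤ n := by
  set S : Set (Matrix (Fin n) (Fin n) ℝ) := (fun v => vecMulVec v v) '' K with hS
  have hSc : IsCompact S := hK.image (by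
    refine continuous_matrix fun i j => ?_
    simp only [vecMulVec_apply]; fun_prop)
  have hC := ks_isCompact_convexHull hSc
  have hn' : (0 : ℝ) < n := by exact_mod_cast hn
  have hmem : (ε ^ 2 / n) • (1 : Matrix (Fin n) (Fin n) ℝ) ∈ convexHull ℝ S := by
    refine mem_convexHull_of_exists_fintype (ι := Fin n) (fun _ => 1 / (n : ℝ))
      (fun i => vecMulVec (Pi.single i ε) (Pi.single i ε)) (fun _ => by positivity) ?_
      (fun i => ⟨_, hKε i, rfl⟩) ?_
    · simp; field_simp
    · ext a b
      simp only [Matrix.sum_apply, Matrix.smul_apply, vecMulVec_apply, smul_eq_mul, one_apply,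
        Pi.single_apply]
      by_cases hab : a = b
      · subst hab; simp; ring
      · have : ∀ x : Fin n, ((if a = x then ε else 0) * (if b = x then ε else 0)) = 0 := by
          intro x
          by_cases h1 : a = x
          · subst h1; simp [Ne.symm hab]
          · simp [h1]
        simp [hab, this]
  obtain ⟨M, hMC, hmax⟩ := hC.exists_isMaxOn ⟨_, hmem⟩
    (f := fun M => M.det) (Continuous.matrix_det continuous_id).continuousOn
  have hpos : 0 < M.det := by
    refine lt_of_lt_of_le ?_ (hmax hmem)
    simp only [det_smul, det_one, mul_one]
    positivity
  obtain ⟨ι, hι, w, z, hw, hw1, hz, hzM⟩ := mem_convexHull_iff_exists_fintype.1 hMC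
  choose v hvK hv using hz
  have hM : ∑ i, w i • vecMulVec (v i) (v i) = M := by
    rw [← hzM]; exact Finset.sum_congr rfl fun i _ => by rw [← hv i]
  refine ⟨ι, hι, w, v, hw, hw1, hvK, by rw [hM]; exact hpos.ne', ?_⟩
  rw [hM]
  intro u hu
  apply ks_real n hn
  intro t ht0 ht1
  have hc : (1 - t) • M + t • vecMulVec u u ∈ convexHull ℝ S :=
    convex_convexHull ℝ S hMC (subset_convexHull ℝ S ⟨u, hu, rfl⟩) (by linarith) ht0.le (by ring)
  have h := hmax hc
  have hne : 1 - t ≠ 0 := by linarith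
  have he : (1 - t) • M + t • vecMulVec u u = (1 - t) • (M + (t / (1 - t)) • vecMulVec u u) := by
    rw [smul_add, smul_smul]; congr 2; field_simp
  simp only [he, det_smul, ks_det M hpos.ne', Fintype.card_fin, Set.mem_ofPred_eq] at h
  by_contra! hh
  nlinarith [mul_lt_mul_of_pos_left hh hpos]

theorem ks_cs {ι : Type*} [Fintype ι] (w a b : ι → ℝ) (hw : ∀ i, 0 ≤ w i) :
    (∑ i, w i * (a i * b i)) ^ 2 ≤ (∑ i, w i * a i ^ 2) * ∑ i, w i * b i ^ 2 :=
  Finset.sum_sq_le_sum_mul_sum_of_sq_le_mul _ (fun i _ => mul_nonneg (hw i) (sq_nonneg _))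
    (fun i _ => mul_nonneg (hw i) (sq_nonneg _)) (fun i _ => le_of_eq (by ring))

open Matrix in
theorem ks_form {n : ℕ} {ι : Type*} [Fintype ι] (w : ι → ℝ) (v : ι → Fin n → ℝ)
    (x : Fin n → ℝ) :
    (∑ i, w i • vecMulVec (v i) (v i)) *ᵥ x = ∑ i, (w i * (v i ⬝ᵥ x)) • v i := by
  rw [sum_mulVec]
  refine Finset.sum_congr rfl fun i _ => ?_
  rw [smul_mulVec, vecMulVec_mulVec, mul_smul]
  simp

/-- Kadec–Snobar: every finite-dimensional subspace `A` of a Banach space `Y` is the range of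
a bounded projection of norm at most `√(dim A)`. -/
theorem kadec_snobar_projection
    (Y : Type*) [NormedAddCommGroup Y] [NormedSpace ℝ Y] [CompleteSpace Y]
    (A : Submodule ℝ Y) [FiniteDimensional ℝ A] :
    ∃ P : Y →L[ℝ] Y, (∀ y : Y, P y ∈ A) ∧ (∀ a ∈ A, P a = a) ∧
      ‖P‖ ≤ Real.sqrt (Module.finrank ℝ A) := by
  rcases Nat.eq_zero_or_pos (Module.finrank ℝ A) with h0 | hn
  · have hA : A = ⊥ := Submodule.finrank_eq_zero.1 h0
    subst hA
    exact ⟨0, by simp, by simp, by simp⟩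
  set n := Module.finrank ℝ A with hndef
  let b : Module.Basis (Fin n) ℝ A := Module.finBasis ℝ A
  let T : StrongDual ℝ A → (Fin n → ℝ) := fun f i => f (b i)
  have hTc : Continuous T := by
    refine continuous_pi fun i => ?_
    exact (ContinuousLinearMap.apply ℝ ℝ (b i)).continuous
  let K : Set (Fin n → ℝ) := T '' Metric.closedBall 0 1
  have : FiniteDimensional ℝ (StrongDual ℝ A) :=
    LinearEquiv.finiteDimensional (LinearMap.toContinuousLinearMap (𝕜 := ℝ) (E := A) (F' := ℝ))
  have : ProperSpace (StrongDual ℝ A) := FiniteDimensional.proper ℝ (StrongDual ℝ A)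
  have hK : IsCompact K := (isCompact_closedBall _ _).image hTc
  have hball : ∀ f : StrongDual ℝ A, f ∈ Metric.closedBall (0 : StrongDual ℝ A) 1 ↔ ‖f‖ ≤ 1 :=
    fun f => mem_closedBall_zero_iff (E := StrongDual ℝ A)
  have hT : ∀ (f : StrongDual ℝ A) (x : A), f x = T f ⬝ᵥ (b.repr x : Fin n → ℝ) := by
    intro f x
    conv_lhs => rw [← b.sum_repr x]
    rw [map_sum, dotProduct]
    exact Finset.sum_congr rfl fun i _ => by simp [T, mul_comm]
  let g : Fin n → StrongDual ℝ A := fun i => LinearMap.toContinuousLinearMap (b.coord i)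
  let ε : ℝ := (1 + ∑ i, ‖g i‖)⁻¹
  have hsum : 0 ≤ ∑ i, ‖g i‖ := Finset.sum_nonneg fun i _ => norm_nonneg (g i)
  have hε : 0 < ε := inv_pos.2 (by linarith)
  have hKε : ∀ i, Pi.single i ε ∈ K := by
    intro i
    refine ⟨ε • g i, ?_, ?_⟩
    · rw [hball]
      have h2 : ‖ε • g i‖ ≤ ‖ε‖ * ‖g i‖ := ContinuousLinearMap.opNorm_smul_le ε (g i)
      rw [Real.norm_of_nonneg hε.le] at h2
      refine h2.trans ?_
      have h1 : ‖g i‖ ≤ ∑ i, ‖g i‖ :=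
        Finset.single_le_sum (f := fun i => ‖g i‖) (fun j _ => norm_nonneg (g j)) (Finset.mem_univ i)
      change (1 + ∑ i, ‖g i‖)⁻¹ * ‖g i‖ ≤ 1
      rw [inv_mul_le_one₀ (by linarith)]
      linarith
    · ext j
      simp [T, g, Pi.single_apply, Finsupp.single_apply]
  obtain ⟨ι, _, w, v, hw, hw1, hvK, hdet, hbound⟩ := ks_design hn K hK ε hε hKε
  have hform := ks_form w v
  set M := ∑ i, w i • Matrix.vecMulVec (v i) (v i) with hM
  have hMu : IsUnit M.det := isUnit_iff_ne_zero.2 hdet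
  choose f hf1 hfv using hvK
  choose F hF hFn using fun i => exists_extension_norm_eq A (f i)
  have hF1 : ∀ i, ‖F i‖ ≤ 1 := fun i => by
    rw [hFn i]; exact (hball _).1 (hf1 i)
  have hquad : ∀ x y : Fin n → ℝ,
      x ⬝ᵥ M.mulVec y = ∑ i, w i * ((v i ⬝ᵥ x) * (v i ⬝ᵥ y)) := by
    intro x y
    rw [hform, dotProduct_sum]
    refine Finset.sum_congr rfl fun i _ => ?_
    rw [dotProduct_smul, smul_eq_mul, dotProduct_comm x]; ring
  have hinv : ∀ x, M.mulVec (M⁻¹.mulVec x) = x := fun x => by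
    rw [Matrix.mulVec_mulVec, Matrix.mul_nonsing_inv _ hMu, Matrix.one_mulVec]
  -- norm bound by the ellipsoid
  have hnorm : ∀ x : A, ‖x‖ ^ 2 ≤ n * ∑ i, w i * (v i ⬝ᵥ (b.repr x : Fin n → ℝ)) ^ 2 := by
    intro x
    obtain ⟨φ, hφ, hφx⟩ := exists_dual_vector'' ℝ x
    have hφK : T φ ∈ K := ⟨φ, (hball _).2 hφ, rfl⟩
    have hb := hbound _ hφK
    set u := M⁻¹.mulVec (T φ) with hu
    have h1 : ‖x‖ = ∑ i, w i * ((v i ⬝ᵥ u) * (v i ⬝ᵥ (b.repr x : Fin n → ℝ))) := by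
      have h2 := hquad (b.repr x) u
      rw [hu, hinv, ← hu, dotProduct_comm, ← hT, hφx] at h2
      rw [show ‖x‖ = _ from h2]
      exact Finset.sum_congr rfl fun i _ => by ring
    have h3 : ∑ i, w i * (v i ⬝ᵥ u) ^ 2 ≤ n := by
      have h2 := hquad u u
      rw [hu, hinv, ← hu, dotProduct_comm] at h2
      rw [h2] at hb
      simpa [sq] using hb
    rw [h1]
    refine (ks_cs w _ _ hw).trans ?_
    exact mul_le_mul_of_nonneg_right h3
      (Finset.sum_nonneg fun i _ => mul_nonneg (hw i) (sq_nonneg _))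
  let c : ι → A := fun i => ∑ j, (M⁻¹.mulVec (v i)) j • b j
  have hc : ∀ i, (b.repr (c i) : Fin n → ℝ) = M⁻¹.mulVec (v i) := fun i => b.repr_sum_self _
  let Q : Y →L[ℝ] A := ∑ i, w i • (F i).smulRight (c i)
  have hQ : ∀ y, Q y = ∑ i, (w i * F i y) • c i := by
    intro y; simp [Q, mul_smul]
  have hQr : ∀ y, M.mulVec (b.repr (Q y) : Fin n → ℝ) = ∑ i, (w i * F i y) • v i := by
    intro y
    have : (b.repr (Q y) : Fin n → ℝ) = ∑ i, (w i * F i y) • M⁻¹.mulVec (v i) := by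
      rw [hQ, map_sum, Finsupp.coe_finsetSum]
      refine Finset.sum_congr rfl fun i _ => ?_
      rw [map_smul, Finsupp.coe_smul, hc]
    rw [this, Matrix.mulVec_sum]
    refine Finset.sum_congr rfl fun i _ => ?_
    rw [Matrix.mulVec_smul, hinv]
  refine ⟨A.subtypeL.comp Q, fun y => (Q y).2, ?_, ?_⟩
  · intro a ha
    have h1 : M.mulVec (b.repr (Q a) : Fin n → ℝ) =
        M.mulVec (b.repr (⟨a, ha⟩ : A) : Fin n → ℝ) := by
      rw [hQr, hform]
      refine Finset.sum_congr rfl fun i _ => ?_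
      rw [← hfv i, ← hT, ← hF i]
    have h2 : (b.repr (Q a) : Fin n → ℝ) = b.repr (⟨a, ha⟩ : A) := by
      have := congrArg (M⁻¹.mulVec) h1
      simpa [Matrix.mulVec_mulVec, Matrix.nonsing_inv_mul _ hMu] using this
    have h3 : Q a = ⟨a, ha⟩ := b.repr.injective (DFunLike.coe_injective h2)
    simp [h3]
  · refine ContinuousLinearMap.opNorm_le_bound _ (Real.sqrt_nonneg _) fun y => ?_
    change ‖Q y‖ ≤ _
    set d : Fin n → ℝ := (b.repr (Q y) : Fin n → ℝ) with hd
    set s := ∑ i, w i * (v i ⬝ᵥ d) ^ 2 with hs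
    have hs0 : 0 ≤ s := Finset.sum_nonneg fun i _ => mul_nonneg (hw i) (sq_nonneg _)
    have hF2 : ∑ i, w i * (F i y) ^ 2 ≤ ‖y‖ ^ 2 := by
      calc ∑ i, w i * (F i y) ^ 2 ≤ ∑ i, w i * ‖y‖ ^ 2 := by
            refine Finset.sum_le_sum fun i _ => mul_le_mul_of_nonneg_left ?_ (hw i)
            have h1 := (F i).le_of_opNorm_le (hF1 i) y
            rw [one_mul, Real.norm_eq_abs] at h1
            exact sq_le_sq' (neg_le_of_abs_le h1) (le_of_abs_le h1)
        _ = ‖y‖ ^ 2 := by rw [← Finset.sum_mul, hw1, one_mul]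
    have hs1 : s = ∑ i, w i * (F i y * (v i ⬝ᵥ d)) := by
      have h1 := hquad d d
      rw [hd, hQr, ← hd, dotProduct_sum] at h1
      rw [hs]
      simp only [sq]
      rw [← h1]
      refine Finset.sum_congr rfl fun i _ => ?_
      rw [dotProduct_smul, smul_eq_mul, dotProduct_comm d]; ring
    have hs2 : s ^ 2 ≤ ‖y‖ ^ 2 * s := by
      have h1 := ks_cs w (fun i => F i y) (fun i => v i ⬝ᵥ d) hw
      rw [← hs1, ← hs] at h1
      exact h1.trans (mul_le_mul_of_nonneg_right hF2 hs0)
    have hs3 : s ≤ ‖y‖ ^ 2 := by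
      by_contra! hh
      have : 0 < s := lt_of_le_of_lt (sq_nonneg _) hh
      nlinarith
    have h4 := hnorm (Q y)
    rw [← Real.sqrt_sq (norm_nonneg y), ← Real.sqrt_mul (Nat.cast_nonneg n)]
    refine Real.le_sqrt_of_sq_le (h4.trans ?_)
    exact mul_le_mul_of_nonneg_left hs3 (Nat.cast_nonneg n)
end

section
/- If X is a Banach space of type 2, then every closed subspace W of X isomorphic to a separable Hilbert space H is complemented in X; moreover there is a projection P : X → W with ‖P‖ ≤ f(T₂(X)) · d(W, H), where d denotes the Banach–Mazur distance and f depends only on the type-2 constant T₂(X). -/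
universe u v

open Finset

/-- `X` has (Rademacher) type 2 with constant `T`: averaging over all choices of signs,
`E‖∑ εᵢ xᵢ‖² ≤ T² ∑‖xᵢ‖²` for all finite sequences in `X`. -/
def HasTypeTwoWithConst (X : Type u) [NormedAddCommGroup X] [NormedSpace ℝ X] (T : ℝ) : Prop :=
  ∀ (n : ℕ) (x : Fin n → X),
    ∑ ε : Fin n → Bool, ‖∑ i, (if ε i then (1 : ℝ) else -1) • x i‖ ^ 2 ≤
      (2 ^ n : ℝ) * T ^ 2 * ∑ i, ‖x i‖ ^ 2

open MeasureTheory ProbabilityTheory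
section
variable {X : Type u} [NormedAddCommGroup X] [NormedSpace ℝ X] {m : ℕ}

lemma gauss_integrable {F : Type*} [NormedAddCommGroup F] [NormedSpace ℝ F]
    (L : EuclideanSpace ℝ (Fin m) →L[ℝ] F) :
    Integrable (fun v => ‖L v‖ ^ 2) (stdGaussian (EuclideanSpace ℝ (Fin m))) := by
  have h := L.comp_memLp' (IsGaussian.memLp_two_id (μ := stdGaussian (EuclideanSpace ℝ (Fin m))))
  exact h.integrable_norm_pow (by norm_num)

lemma gauss_inv {F : Type*} [NormedAddCommGroup F] [NormedSpace ℝ F]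
    (L : EuclideanSpace ℝ (Fin m) →L[ℝ] F)
    (g : EuclideanSpace ℝ (Fin m) ≃ₗᵢ[ℝ] EuclideanSpace ℝ (Fin m)) :
    ∫ v, ‖L (g v)‖ ^ 2 ∂(stdGaussian (EuclideanSpace ℝ (Fin m))) =
    ∫ v, ‖L v‖ ^ 2 ∂(stdGaussian (EuclideanSpace ℝ (Fin m))) := by
  conv_rhs => rw [← stdGaussian_map g]
  rw [integral_map]
  · fun_prop
  · exact (Continuous.aestronglyMeasurable (by fun_prop))

lemma gauss_cov (i j : Fin m) :
    ∫ v, v i * v j ∂(stdGaussian (EuclideanSpace ℝ (Fin m))) = if i = j then 1 else 0 := by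
  have h := ProbabilityTheory.covarianceBilin_apply
    (IsGaussian.memLp_two_id (μ := stdGaussian (EuclideanSpace ℝ (Fin m))))
    (EuclideanSpace.basisFun (Fin m) ℝ i) (EuclideanSpace.basisFun (Fin m) ℝ j)
  rw [covarianceBilin_stdGaussian] at h
  have h2 : ∫ x, id x ∂(stdGaussian (EuclideanSpace ℝ (Fin m))) = 0 := integral_id_stdGaussian
  rw [h2] at h
  have h3 : innerSL ℝ (EuclideanSpace.basisFun (Fin m) ℝ i) (EuclideanSpace.basisFun (Fin m) ℝ j)
      = if i = j then (1 : ℝ) else 0 :=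
    orthonormal_iff_ite.1 (EuclideanSpace.basisFun (Fin m) ℝ).orthonormal i j
  rw [← h3]
  refine Eq.trans ?_ h.symm
  simp only [EuclideanSpace.basisFun_apply, EuclideanSpace.inner_single_left, sub_zero]
  simp

lemma gauss_int_mul (i j : Fin m) :
    Integrable (fun v => v i * v j) (stdGaussian (EuclideanSpace ℝ (Fin m))) := by
  have h := fun i : Fin m => (EuclideanSpace.proj i : EuclideanSpace ℝ (Fin m) →L[ℝ] ℝ).comp_memLp'
    (IsGaussian.memLp_two_id (μ := stdGaussian (EuclideanSpace ℝ (Fin m))))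
  exact (h i).integrable_mul (h j)

lemma clm_expand {F : Type*} [NormedAddCommGroup F] [NormedSpace ℝ F]
    (L : EuclideanSpace ℝ (Fin m) →L[ℝ] F) (v : EuclideanSpace ℝ (Fin m)) :
    L v = ∑ i, v i • L (EuclideanSpace.single i 1) := by
  conv_lhs => rw [← (EuclideanSpace.basisFun (Fin m) ℝ).sum_repr v]
  simp

lemma gauss_hs {H : Type*} [NormedAddCommGroup H] [InnerProductSpace ℝ H]
    (B : EuclideanSpace ℝ (Fin m) →L[ℝ] H) :
    ∫ v, ‖B v‖ ^ 2 ∂(stdGaussian (EuclideanSpace ℝ (Fin m))) =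
      ∑ i, ‖B (EuclideanSpace.single i 1)‖ ^ 2 := by
  have : ∀ v, ‖B v‖ ^ 2 = ∑ i, ∑ j, (v i * v j) *
      inner ℝ (B (EuclideanSpace.single i 1)) (B (EuclideanSpace.single j 1)) := by
    intro v
    rw [← real_inner_self_eq_norm_sq, clm_expand B v, sum_inner]
    simp only [inner_sum, real_inner_smul_left, real_inner_smul_right]
    refine Finset.sum_congr rfl fun i _ => Finset.sum_congr rfl fun j _ => ?_
    ring
  simp_rw [this]
  rw [integral_finsetSum _ (fun i _ => integrable_finsetSum _ fun j _ =>
    (gauss_int_mul i j).mul_const _)]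
  refine Finset.sum_congr rfl fun i _ => ?_
  rw [integral_finsetSum _ (fun j _ => (gauss_int_mul i j).mul_const _)]
  simp_rw [integral_mul_const, gauss_cov]
  simp

lemma gauss_type {T : ℝ} (hT : HasTypeTwoWithConst X T)
    (L : EuclideanSpace ℝ (Fin m) →L[ℝ] X) :
    ∫ v, ‖L v‖ ^ 2 ∂(stdGaussian (EuclideanSpace ℝ (Fin m))) ≤
      T ^ 2 * ∑ i, ‖L (EuclideanSpace.single i 1)‖ ^ 2 := by
  set x : Fin m → X := fun i => L (EuclideanSpace.single i 1) with hx
  let g : (Fin m → Bool) → EuclideanSpace ℝ (Fin m) ≃ₗᵢ[ℝ] EuclideanSpace ℝ (Fin m) := fun ε =>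
    LinearIsometryEquiv.piLpCongrRight 2
      (fun i => if ε i then LinearIsometryEquiv.refl ℝ ℝ else LinearIsometryEquiv.neg ℝ)
  have hg : ∀ ε v, L (g ε v) = ∑ i, (if ε i then (1 : ℝ) else -1) • (v i • x i) := by
    intro ε v
    rw [clm_expand]
    refine Finset.sum_congr rfl fun i _ => ?_
    simp only [g, LinearIsometryEquiv.piLpCongrRight_apply, hx]
    cases ε i <;> simp
  have h1 : (2 ^ m : ℝ) * ∫ v, ‖L v‖ ^ 2 ∂(stdGaussian (EuclideanSpace ℝ (Fin m))) =
      ∫ v, ∑ ε, ‖L (g ε v)‖ ^ 2 ∂(stdGaussian (EuclideanSpace ℝ (Fin m))) := by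
    rw [integral_finsetSum _ (fun ε _ => by
      exact gauss_integrable (L.comp (g ε).toContinuousLinearEquiv.toContinuousLinearMap))]
    simp_rw [gauss_inv L]
    simp
  have h2 : ∫ v, ∑ ε, ‖L (g ε v)‖ ^ 2 ∂(stdGaussian (EuclideanSpace ℝ (Fin m))) ≤
      ∫ v, (2 ^ m : ℝ) * T ^ 2 * ∑ i, (v i * v i) * ‖x i‖ ^ 2
        ∂(stdGaussian (EuclideanSpace ℝ (Fin m))) := by
    refine integral_mono (integrable_finsetSum _ (fun ε _ => by
      exact gauss_integrable (L.comp (g ε).toContinuousLinearEquiv.toContinuousLinearMap)))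
      ((integrable_finsetSum _ fun i _ => (gauss_int_mul i i).mul_const _).const_mul _) ?_
    intro v
    simp only [hg]
    refine (hT m (fun i => v i • x i)).trans (le_of_eq ?_)
    congr 1
    refine Finset.sum_congr rfl fun i _ => ?_
    rw [norm_smul, mul_pow, Real.norm_eq_abs, sq_abs, sq]
  rw [integral_const_mul, integral_finsetSum _ (fun i _ => (gauss_int_mul i i).mul_const _)] at h2
  simp_rw [integral_mul_const, gauss_cov] at h2
  rw [← h1, mul_assoc] at h2
  have := le_of_mul_le_mul_left h2 (by positivity)
  simpa using this

lemma gauss_main {H : Type v} [NormedAddCommGroup H] [InnerProductSpace ℝ H]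
    {T : ℝ} (hT : HasTypeTwoWithConst X T)
    (L : EuclideanSpace ℝ (Fin m) →L[ℝ] X) (V : Submodule ℝ (EuclideanSpace ℝ (Fin m)))
    (B : EuclideanSpace ℝ (Fin m) →L[ℝ] H) (K : ℝ)
    (hB : ∀ v, ‖B v‖ ≤ K * ‖L (V.starProjection v)‖) :
    ∑ i, ‖B (EuclideanSpace.single i 1)‖ ^ 2 ≤
      K ^ 2 * (T ^ 2 * ∑ i, ‖L (EuclideanSpace.single i 1)‖ ^ 2) := by
  rw [← gauss_hs]
  have h1 : ∀ v, ‖B v‖ ^ 2 ≤ K ^ 2 * (2⁻¹ * (‖L v‖ ^ 2 + ‖L (V.reflection v)‖ ^ 2)) := by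
    intro v
    have e : L (V.starProjection v) = (2⁻¹ : ℝ) • (L v + L (V.reflection v)) := by
      rw [← map_add, ← map_smul, Submodule.reflection_apply]
      congr 1
      module
    have e2 : ‖L (V.starProjection v)‖ ≤ 2⁻¹ * (‖L v‖ + ‖L (V.reflection v)‖) := by
      rw [e, norm_smul]
      norm_num
      exact norm_add_le _ _
    have e3 : ‖L (V.starProjection v)‖ ^ 2 ≤ 2⁻¹ * (‖L v‖ ^ 2 + ‖L (V.reflection v)‖ ^ 2) := by
      have := pow_le_pow_left₀ (norm_nonneg _) e2 2
      nlinarith [sq_nonneg (‖L v‖ - ‖L (V.reflection v)‖)]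
    calc ‖B v‖ ^ 2 ≤ (K * ‖L (V.starProjection v)‖) ^ 2 :=
          pow_le_pow_left₀ (norm_nonneg _) (hB v) 2
      _ ≤ _ := by rw [mul_pow]; gcongr
  have i1 := gauss_integrable L
  have i2 : Integrable (fun v => ‖L (V.reflection v)‖ ^ 2)
      (stdGaussian (EuclideanSpace ℝ (Fin m))) :=
    gauss_integrable (L.comp V.reflection.toContinuousLinearEquiv.toContinuousLinearMap)
  have h2 := integral_mono (gauss_integrable B) (((i1.add i2).const_mul 2⁻¹).const_mul (K ^ 2)) h1
  refine h2.trans ?_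
  simp only [Pi.add_apply]
  rw [integral_const_mul, integral_const_mul, integral_add i1 i2, gauss_inv L]
  have := gauss_type hT L
  refine mul_le_mul_of_nonneg_left ?_ (sq_nonneg K)
  linarith
end

section
open scoped TensorProduct
variable {X : Type u} [NormedAddCommGroup X] [NormedSpace ℝ X]
  {H : Type v} [NormedAddCommGroup H] [InnerProductSpace ℝ H]

/-- Contraction of the second tensor factor against `h`. -/
noncomputable def contr (M : Type*) [AddCommGroup M] [Module ℝ M] (h : H) : M ⊗[ℝ] H →ₗ[ℝ] M :=
  TensorProduct.lift (LinearMap.mk₂ ℝ (fun y k => (inner ℝ k h : ℝ) • y)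
    (by intros; simp) (by intro c y k; exact smul_comm _ _ _)
    (by intros; simp [inner_add_left, add_smul])
    (by intros; simp [real_inner_smul_left, mul_smul]))

lemma contr_tmul (M : Type*) [AddCommGroup M] [Module ℝ M] (h : H) (y : M) (k : H) :
    contr M h (y ⊗ₜ k) = (inner ℝ k h : ℝ) • y := rfl

/-- The trace functional on `W ⊗ H` attached to `u`. -/
noncomputable def trf {W : Submodule ℝ X} (u : W →L[ℝ] H) : W ⊗[ℝ] H →ₗ[ℝ] ℝ :=
  TensorProduct.lift (LinearMap.mk₂ ℝ (fun y k => (inner ℝ (u y) k : ℝ))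
    (by intros; simp [inner_add_left]) (by intros; simp [real_inner_smul_left])
    (by intros; simp [inner_add_right])
    (by intros; simp [real_inner_smul_right]))

lemma trf_tmul {W : Submodule ℝ X} (u : W →L[ℝ] H) (y : W) (k : H) :
    trf u (y ⊗ₜ k) = (inner ℝ (u y) k : ℝ) := rfl

lemma subtype_inj (W : Submodule ℝ X) :
    Function.Injective (LinearMap.rTensor H W.subtype) :=
  Module.Flat.rTensor_preserves_injective_linearMap _ W.subtype_injective

lemma contr_nat (W : Submodule ℝ X) (h : H) (τ : W ⊗[ℝ] H) :
    ((contr W h τ : W) : X) = contr X h (LinearMap.rTensor H W.subtype τ) := by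
  induction τ using TensorProduct.induction_on with
  | zero => simp
  | tmul y k => simp [contr_tmul]
  | add a b ha hb => simp [ha, hb]

lemma key_ineq {T : ℝ} (hT : HasTypeTwoWithConst X T) (W : Submodule ℝ X) (u : W →L[ℝ] H)
    {m : ℕ} (x : Fin m → X) (k : Fin m → H) (τ : W ⊗[ℝ] H)
    (hτ : LinearMap.rTensor H W.subtype τ = ∑ i, x i ⊗ₜ[ℝ] k i) :
    trf u τ ≤ ‖u‖ * |T| * (√(∑ i, ‖x i‖ ^ 2) * √(∑ i, ‖k i‖ ^ 2)) := by
  classical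
  let A : H →ₗ[ℝ] EuclideanSpace ℝ (Fin m) :=
    { toFun := fun h => WithLp.toLp 2 (fun i => (inner ℝ (k i) h : ℝ))
      map_add' := by intro a b; ext i; simp [inner_add_right]
      map_smul' := by intro a b; ext i; simp [real_inner_smul_right] }
  have hA : ∀ h i, A h i = inner ℝ (k i) h := fun h i => rfl
  let V : Submodule ℝ (EuclideanSpace ℝ (Fin m)) := LinearMap.range A
  let L : EuclideanSpace ℝ (Fin m) →L[ℝ] X :=
    ∑ i, (EuclideanSpace.proj i : EuclideanSpace ℝ (Fin m) →L[ℝ] ℝ).smulRight (x i)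
  have hL : ∀ v, L v = ∑ i, v i • x i := by intro v; simp [L]
  have hLe : ∀ i, L (EuclideanSpace.single i 1) = x i := by
    intro i; rw [hL]; simp
  have hLV : ∀ v ∈ V, L v ∈ W := by
    rintro _ ⟨h, rfl⟩
    have e : L (A h) = ((contr W h τ : W) : X) := by
      rw [contr_nat, hτ, map_sum, hL]
      rfl
    rw [e]; exact Subtype.property _
  let LW : EuclideanSpace ℝ (Fin m) →L[ℝ] W :=
    (L.comp V.starProjection).codRestrict W (fun v => hLV _ (V.starProjection_apply_mem v))
  have hLW : ∀ v, ((LW v : W) : X) = L (V.starProjection v) := fun v => rfl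
  have hproj : ∑ i, (V.starProjection (EuclideanSpace.single i 1)) ⊗ₜ[ℝ] k i =
      ∑ i, (EuclideanSpace.single i (1 : ℝ) : EuclideanSpace ℝ (Fin m)) ⊗ₜ[ℝ] k i := by
    have hk : ∀ j, ∑ i, (V.starProjection (EuclideanSpace.single i 1)) j • k i = k j := by
      intro j
      refine ext_inner_right ℝ fun h => ?_
      have e1 : V.starProjection (A h) = A h :=
        Submodule.starProjection_eq_self_iff.2 ⟨h, rfl⟩
      rw [← hA h j, ← e1, clm_expand V.starProjection (A h), sum_inner]
      simp [real_inner_smul_left, hA, mul_comm]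
    have e2 : ∀ i, V.starProjection (EuclideanSpace.single i 1) =
        ∑ j, (V.starProjection (EuclideanSpace.single i 1)) j •
          (EuclideanSpace.single j (1 : ℝ) : EuclideanSpace ℝ (Fin m)) := by
      intro i
      exact clm_expand (ContinuousLinearMap.id ℝ _) _
    calc _ = ∑ i, ∑ j, (EuclideanSpace.single j (1 : ℝ) : EuclideanSpace ℝ (Fin m)) ⊗ₜ[ℝ]
            ((V.starProjection (EuclideanSpace.single i 1)) j • k i) := by
          refine Finset.sum_congr rfl fun i _ => ?_
          conv_lhs => rw [e2 i]
          rw [TensorProduct.sum_tmul]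
          simp only [TensorProduct.smul_tmul]
      _ = _ := by
          rw [Finset.sum_comm]
          refine Finset.sum_congr rfl fun j _ => ?_
          rw [← TensorProduct.tmul_sum, hk]
  have hτ2 : τ = ∑ i, LW (EuclideanSpace.single i 1) ⊗ₜ[ℝ] k i := by
    apply subtype_inj W
    rw [hτ, map_sum]
    have := congrArg (LinearMap.rTensor H (L : EuclideanSpace ℝ (Fin m) →ₗ[ℝ] X)) hproj
    rw [map_sum, map_sum] at this
    simp only [LinearMap.rTensor_tmul, ContinuousLinearMap.coe_coe, hLe] at this
    rw [← this]
    rfl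
  have hm := gauss_main hT L V (u.comp LW) ‖u‖ (fun v => by
    rw [← hLW]
    exact u.le_opNorm (LW v))
  simp only [hLe] at hm
  rw [hτ2, map_sum]
  simp only [trf_tmul]
  calc ∑ i, inner ℝ (u (LW (EuclideanSpace.single i 1))) (k i)
      ≤ ∑ i, ‖u (LW (EuclideanSpace.single i 1))‖ * ‖k i‖ :=
        Finset.sum_le_sum fun i _ => real_inner_le_norm _ _
    _ ≤ √(∑ i, ‖u (LW (EuclideanSpace.single i 1))‖ ^ 2) * √(∑ i, ‖k i‖ ^ 2) :=
        Real.sum_mul_le_sqrt_mul_sqrt _ _ _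
    _ ≤ (‖u‖ * |T| * √(∑ i, ‖x i‖ ^ 2)) * √(∑ i, ‖k i‖ ^ 2) := by
        gcongr
        refine (Real.sqrt_le_sqrt hm).trans (le_of_eq ?_)
        rw [Real.sqrt_mul (sq_nonneg _), Real.sqrt_mul (sq_nonneg _), Real.sqrt_sq (norm_nonneg u),
          Real.sqrt_sq_eq_abs, mul_assoc]
    _ = _ := by ring

lemma scale_tmul (x : X) (k : H) (s : ℝ) : ∃ (x' : X) (k' : H),
    x' ⊗ₜ[ℝ] k' = s • (x ⊗ₜ[ℝ] k) ∧ ‖x'‖ ^ 2 = |s| * ‖x‖ * ‖k‖ ∧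
      ‖k'‖ ^ 2 = |s| * ‖x‖ * ‖k‖ := by
  by_cases ha : |s| * ‖x‖ * ‖k‖ = 0
  · refine ⟨0, 0, ?_, by simp [ha], by simp [ha]⟩
    simp only [mul_eq_zero, abs_eq_zero, norm_eq_zero] at ha
    rcases ha with (rfl | rfl) | rfl <;> simp
  · have hpos : 0 < |s| * ‖x‖ * ‖k‖ := lt_of_le_of_ne (by positivity) (Ne.symm ha)
    set a := |s| * ‖x‖ * ‖k‖ with hadef
    have hx : ‖x‖ ≠ 0 := by rintro h; apply ha; rw [hadef, h]; ring
    have hsq : √a ^ 2 = a := Real.sq_sqrt hpos.le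
    have hs0 : √a ≠ 0 := (Real.sqrt_pos.2 hpos).ne'
    refine ⟨(√a / ‖x‖) • x, (s * ‖x‖ / √a) • k, ?_, ?_, ?_⟩
    · rw [TensorProduct.smul_tmul_smul]
      congr 1
      field_simp
    · rw [norm_smul, norm_div, norm_norm, Real.norm_eq_abs, abs_of_nonneg (Real.sqrt_nonneg _),
        div_mul_cancel₀ _ hx, hsq]
    · rw [norm_smul, norm_div, norm_mul, norm_norm, Real.norm_eq_abs, Real.norm_eq_abs,
        abs_of_nonneg (Real.sqrt_nonneg _), mul_pow, div_pow, hsq]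
      rw [div_mul_eq_mul_div, div_eq_iff ha, hadef]; ring

lemma key_ineq_finsupp {T : ℝ} (hT : HasTypeTwoWithConst X T) (W : Submodule ℝ X)
    (u : W →L[ℝ] H) (s : (X × H) →₀ ℝ) (τ : W ⊗[ℝ] H)
    (hτ : LinearMap.rTensor H W.subtype τ =
      Finsupp.linearCombination ℝ (fun p : X × H => p.1 ⊗ₜ[ℝ] p.2) s) :
    trf u τ ≤ ‖u‖ * |T| * s.sum (fun p c => |c| * ‖p.1‖ * ‖p.2‖) := by
  classical
  choose x' k' h1 h2 h3 using fun p : X × H => scale_tmul p.1 p.2 (s p)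
  let σ := s.support.equivFin.symm
  have conv : ∀ {M : Type (max u v)} [AddCommMonoid M] (F : X × H → M),
      ∑ p ∈ s.support, F p = ∑ i, F (σ i) := by
    intro M _ F
    rw [← Finset.sum_coe_sort]
    exact (Equiv.sum_comp σ (fun p => F p)).symm
  have convR : ∀ (F : X × H → ℝ), ∑ p ∈ s.support, F p = ∑ i, F (σ i) := by
    intro F
    rw [← Finset.sum_coe_sort]
    exact (Equiv.sum_comp σ (fun p => F p)).symm
  have := key_ineq hT W u (fun i => x' (σ i)) (fun i => k' (σ i)) τ (by
    rw [hτ, Finsupp.linearCombination_apply, Finsupp.sum, conv]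
    simp only [h1])
  refine this.trans (le_of_eq ?_)
  simp only [h2, h3]
  rw [Real.mul_self_sqrt (Finset.sum_nonneg fun i _ => by positivity), Finsupp.sum, convR]

lemma extend_op [CompleteSpace H] {T : ℝ} (hT : HasTypeTwoWithConst X T) (W : Submodule ℝ X)
    (u : W →L[ℝ] H) :
    ∃ U : X →L[ℝ] H, (∀ w : W, U w = u w) ∧ ‖U‖ ≤ ‖u‖ * |T| := by
  classical
  let π : ((X × H) →₀ ℝ) →ₗ[ℝ] X ⊗[ℝ] H :=
    Finsupp.linearCombination ℝ (fun p : X × H => p.1 ⊗ₜ[ℝ] p.2)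
  let ι : W ⊗[ℝ] H →ₗ[ℝ] X ⊗[ℝ] H := LinearMap.rTensor H W.subtype
  have hι : Function.Injective ι := subtype_inj W
  let D : Submodule ℝ ((X × H) →₀ ℝ) := (LinearMap.range ι).comap π
  let ψ : D →ₗ[ℝ] LinearMap.range ι := (π.comp D.subtype).codRestrict _ (fun z => z.2)
  let f : ((X × H) →₀ ℝ) →ₗ.[ℝ] ℝ :=
    { domain := D
      toFun := (trf u).comp ((LinearEquiv.ofInjective ι hι).symm.toLinearMap.comp ψ) }
  have hf : ∀ z : f.domain, ∃ τ, ι τ = π z ∧ f z = trf u τ := by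
    intro z
    refine ⟨(LinearEquiv.ofInjective ι hι).symm (ψ z), ?_, rfl⟩
    have := (LinearEquiv.ofInjective ι hι).apply_symm_apply (ψ z)
    exact congrArg Subtype.val this
  let N : ((X × H) →₀ ℝ) → ℝ := fun s => ‖u‖ * |T| * s.sum (fun p c => |c| * ‖p.1‖ * ‖p.2‖)
  have hsum : ∀ (s : (X × H) →₀ ℝ) (S : Finset (X × H)), s.support ⊆ S →
      s.sum (fun p c => |c| * ‖p.1‖ * ‖p.2‖) = ∑ p ∈ S, |s p| * ‖p.1‖ * ‖p.2‖ := by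
    intro s S hS
    exact Finsupp.sum_of_support_subset _ hS _ (by simp)
  obtain ⟨g, hg, hgN⟩ := exists_extension_of_le_sublinear f N
    (by
      intro c hc s
      simp only [N]
      rw [hsum (c • s) s.support Finsupp.support_smul, hsum s s.support subset_rfl, Finset.mul_sum,
        Finset.mul_sum, Finset.mul_sum]
      refine Finset.sum_congr rfl fun p _ => ?_
      rw [Finsupp.smul_apply, smul_eq_mul, abs_mul, abs_of_pos hc]; ring)
    (by
      intro s t
      simp only [N]
      rw [hsum (s + t) (s.support ∪ t.support) Finsupp.support_add,
        hsum s (s.support ∪ t.support) Finset.subset_union_left,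
        hsum t (s.support ∪ t.support) Finset.subset_union_right, ← mul_add,
        ← Finset.sum_add_distrib]
      gcongr with p
      rw [Finsupp.add_apply, ← add_mul, ← add_mul]
      gcongr
      exact abs_add_le _ _)
    (by
      intro z
      obtain ⟨τ, h1, h2⟩ := hf z
      rw [h2]
      exact key_ineq_finsupp hT W u z τ h1)
  have hgτ : ∀ (z : (X × H) →₀ ℝ) (τ : W ⊗[ℝ] H), ι τ = π z → g z = trf u τ := by
    intro z τ h
    have hz : z ∈ f.domain := ⟨τ, h⟩
    obtain ⟨τ', h1, h2⟩ := hf ⟨z, hz⟩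
    have : τ' = τ := hι (h1.trans h.symm)
    rw [← this, ← h2, ← hg]
  have hg0 : ∀ z w, π z = π w → g z = g w := by
    intro z w h
    have := hgτ (z - w) 0 (by rw [map_sub, h, sub_self, map_zero])
    rw [map_sub, map_zero] at this
    linarith
  have hπ : ∀ (x : X) (k : H) (c : ℝ), π (Finsupp.single (x, k) c) = c • (x ⊗ₜ[ℝ] k) := by
    intro x k c; simp [π]
  let b : X →ₗ[ℝ] H →ₗ[ℝ] ℝ := LinearMap.mk₂ ℝ (fun x k => g (Finsupp.single (x, k) 1))
    (by
      intro x y k; rw [← map_add]; apply hg0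
      simp [hπ, TensorProduct.add_tmul])
    (by
      intro c x k; rw [← map_smul]; apply hg0
      rw [map_smul]; simp [hπ, TensorProduct.smul_tmul'])
    (by
      intro x k l; rw [← map_add]; apply hg0
      simp [hπ, TensorProduct.tmul_add])
    (by
      intro c x k; rw [← map_smul]; apply hg0
      rw [map_smul]; simp [hπ])
  have hb : ∀ x k, b x k = g (Finsupp.single (x, k) 1) := fun _ _ => rfl
  have hle : ∀ x k, b x k ≤ ‖u‖ * |T| * ‖x‖ * ‖k‖ := by
    intro x k
    refine (hgN _).trans (le_of_eq ?_)
    simp only [N]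
    rw [Finsupp.sum_single_index (by simp)]
    simp; ring
  have hbn : ∀ x k, ‖b x k‖ ≤ ‖u‖ * |T| * ‖x‖ * ‖k‖ := by
    intro x k
    rw [Real.norm_eq_abs, abs_le]
    have := hle (-x) k
    rw [norm_neg, map_neg, LinearMap.neg_apply] at this
    exact ⟨by linarith, hle x k⟩
  let bc : X →L[ℝ] H →L[ℝ] ℝ := b.mkContinuous₂ (‖u‖ * |T|) hbn
  have hbc : ‖bc‖ ≤ ‖u‖ * |T| := LinearMap.mkContinuous₂_norm_le _ (by positivity) _
  let U₀ : X →ₗ[ℝ] H :=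
    { toFun := fun x => (InnerProductSpace.toDual ℝ H).symm (bc x)
      map_add' := by intro x y; simp
      map_smul' := by intro c x; simp }
  refine ⟨U₀.mkContinuous (‖u‖ * |T|) ?_, ?_, LinearMap.mkContinuous_norm_le _ (by positivity) _⟩
  · intro x
    change ‖(InnerProductSpace.toDual ℝ H).symm (bc x)‖ ≤ _
    rw [LinearIsometryEquiv.norm_map]
    exact (bc.le_opNorm x).trans (by gcongr)
  · intro w
    refine ext_inner_right ℝ fun h => ?_
    change inner ℝ ((InnerProductSpace.toDual ℝ H).symm (bc w)) h = _
    rw [InnerProductSpace.toDual_symm_apply]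
    change g (Finsupp.single ((w : X), h) 1) = _
    rw [hgτ _ (w ⊗ₜ h) (by simp [hπ, ι]), trf_tmul]

end

/-- Maurey's theorem: there is a function `f` such that in every Banach space `X` of type 2
(with constant `T`), every closed subspace `W` isomorphic to a separable Hilbert space `H` is
complemented by a projection of norm at most `f T · d(W, H)`, where `d` is the Banach–Mazur
distance. -/
theorem maurey_type_two_hilbert_complemented :
    ∃ f : ℝ → ℝ,
      ∀ (X : Type u) (_ : NormedAddCommGroup X) (_ : NormedSpace ℝ X) (_ : CompleteSpace X)
        (T : ℝ), HasTypeTwoWithConst X T →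
      ∀ (W : Submodule ℝ X), IsClosed (W : Set X) →
      ∀ (H : Type v) (_ : NormedAddCommGroup H) (_ : InnerProductSpace ℝ H)
        (_ : CompleteSpace H) (_ : TopologicalSpace.SeparableSpace H),
        Nonempty (W ≃L[ℝ] H) →
        ∃ P : X →L[ℝ] X, (∀ x : X, P x ∈ W) ∧ (∀ w ∈ W, P w = w) ∧
          ‖P‖ ≤ f T * ⨅ e : W ≃L[ℝ] H, ‖(e : W →L[ℝ] H)‖ * ‖(e.symm : H →L[ℝ] W)‖ := by
  refine ⟨fun T => 2 * |T|, ?_⟩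
  intro X _ _ _ T hT W hW H _ _ _ _ ⟨e₀⟩
  have : Nonempty (W ≃L[ℝ] H) := ⟨e₀⟩
  have hbdd : BddBelow (Set.range fun e : W ≃L[ℝ] H =>
      ‖(e : W →L[ℝ] H)‖ * ‖(e.symm : H →L[ℝ] W)‖) :=
    ⟨0, by rintro _ ⟨e, rfl⟩; positivity⟩
  by_cases hW0 : ∀ w : W, w = 0
  · refine ⟨0, fun x => by simp, fun w hw => ?_, ?_⟩
    · have := congrArg Subtype.val (hW0 ⟨w, hw⟩)
      simpa using this.symm
    · rw [norm_zero]
      exact mul_nonneg (by positivity) (Real.iInf_nonneg fun e => by positivity)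
  · push Not at hW0
    obtain ⟨w₀, hw₀⟩ := hW0
    have hone : ∀ e : W ≃L[ℝ] H, 1 ≤ ‖(e : W →L[ℝ] H)‖ * ‖(e.symm : H →L[ℝ] W)‖ := by
      intro e
      have h1 : ‖w₀‖ ≤ ‖(e.symm : H →L[ℝ] W)‖ * (‖(e : W →L[ℝ] H)‖ * ‖w₀‖) := by
        calc ‖w₀‖ = ‖(e.symm : H →L[ℝ] W) ((e : W →L[ℝ] H) w₀)‖ := by simp
          _ ≤ _ := (ContinuousLinearMap.le_opNorm _ _).trans
            (mul_le_mul_of_nonneg_left (ContinuousLinearMap.le_opNorm _ _) (norm_nonneg _))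
      have h2 : 0 < ‖w₀‖ := norm_pos_iff.2 hw₀
      by_contra hlt
      push Not at hlt
      nlinarith
    have hd : 1 ≤ ⨅ e : W ≃L[ℝ] H, ‖(e : W →L[ℝ] H)‖ * ‖(e.symm : H →L[ℝ] W)‖ := le_ciInf hone
    set d := ⨅ e : W ≃L[ℝ] H, ‖(e : W →L[ℝ] H)‖ * ‖(e.symm : H →L[ℝ] W)‖ with hd_def
    obtain ⟨e, he⟩ := exists_lt_of_ciInf_lt (show d < 2 * d by linarith)
    obtain ⟨U, hU, hUn⟩ := extend_op hT W (e : W →L[ℝ] H)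
    refine ⟨W.subtypeL.comp ((e.symm : H →L[ℝ] W).comp U), fun x => ?_, fun w hw => ?_, ?_⟩
    · simp
    · have := hU ⟨w, hw⟩
      simp only [ContinuousLinearMap.comp_apply]
      simp at this
      simp [this]
    · refine ContinuousLinearMap.opNorm_le_bound _ (by positivity) fun x => ?_
      calc ‖((e.symm : H →L[ℝ] W) (U x) : W)‖
          ≤ ‖(e.symm : H →L[ℝ] W)‖ * (‖U‖ * ‖x‖) := (ContinuousLinearMap.le_opNorm _ _).trans
            (mul_le_mul_of_nonneg_left (ContinuousLinearMap.le_opNorm _ _) (norm_nonneg _))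
        _ ≤ ‖(e.symm : H →L[ℝ] W)‖ * ((‖(e : W →L[ℝ] H)‖ * |T|) * ‖x‖) := by gcongr
        _ = |T| * (‖(e : W →L[ℝ] H)‖ * ‖(e.symm : H →L[ℝ] W)‖) * ‖x‖ := by ring
        _ ≤ |T| * (2 * d) * ‖x‖ := by gcongr
        _ = _ := by ring
end
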